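/- Let p > 0, K ⊆ ℝ⁺ a p-convex set, h : ℝ⁺ → ℝ⁺ a super-multiplicative function, and f an operator (p,h)-convex function on K. Let M and E be finite nonempty disjoint sets of positive integers, wᵢ > 0 weights, and Aᵢ (i ∈ M ∪ E) positive semidefinite matrices with spectra in K. Then F(M ∪ E) ≤ F(M) + F(E), where F(S) = h(W_S)·f([W_S⁻¹ Σ_{i∈S} wᵢ Aᵢ^p]^{1/p}) − Σ_{i∈S} h(wᵢ) f(Aᵢ) and W_S = Σ_{i∈S} wᵢ. -/

import Mathlib

open Matrix
open scoped ComplexOrder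

/-- The matrix `A` raised to the real power `p`, defined via the continuous
functional calculus (using the real power function `Real.rpow`). -/
noncomputable def mpow {n : ℕ} (A : Matrix (Fin n) (Fin n) ℂ) (p : ℝ) :
    Matrix (Fin n) (Fin n) ℂ :=
  cfc (fun x : ℝ => x ^ p) A

/-- The Loewner order on matrices: `loewnerLE X Y` iff `Y - X` is positive semidefinite. -/
def loewnerLE {n : ℕ} (X Y : Matrix (Fin n) (Fin n) ℂ) : Prop :=
  (Y - X).PosSemidef

/-- A set `K ⊆ ℝ` is `p`-convex if `(l*x^p + (1-l)*y^p)^(1/p) ∈ K` for all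
`x, y ∈ K` and `l ∈ [0,1]`. -/
def PConvex (p : ℝ) (K : Set ℝ) : Prop :=
  ∀ x ∈ K, ∀ y ∈ K, ∀ l ∈ Set.Icc (0 : ℝ) 1,
    (l * x ^ p + (1 - l) * y ^ p) ^ (1 / p) ∈ K

/-- `h` is super-multiplicative on `J`: `h (x*y) ≥ h x * h y` for all `x, y ∈ J`. -/
def SuperMultiplicativeOn (J : Set ℝ) (h : ℝ → ℝ) : Prop :=
  ∀ x ∈ J, ∀ y ∈ J, h x * h y ≤ h (x * y)

/-- `f` is operator `(p,h)`-convex on `K`: `f` is nonnegative and continuous on `K`, and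
`f([α A^p + (1-α) B^p]^{1/p}) ≤ h(α) f(A) + h(1-α) f(B)` (in the Loewner order) for all
positive semidefinite matrices `A, B` (of any order `n`) with spectra in `K` and all
`α ∈ (0,1)`, where matrix functions are taken via the continuous functional calculus. -/
def OperatorPHConvexOn (p : ℝ) (K : Set ℝ) (h : ℝ → ℝ) (f : ℝ → ℝ) : Prop :=
  (∀ x ∈ K, 0 ≤ f x) ∧ ContinuousOn f K ∧
  ∀ (n : ℕ) (A B : Matrix (Fin n) (Fin n) ℂ),
    A.PosSemidef → B.PosSemidef → spectrum ℝ A ⊆ K → spectrum ℝ B ⊆ K →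
    ∀ α ∈ Set.Ioo (0 : ℝ) 1,
      loewnerLE (cfc f (mpow (α • mpow A p + (1 - α) • mpow B p) (1 / p)))
        (h α • cfc f A + h (1 - α) • cfc f B)

/-- The index set function
`F(S) = h(W_S) • f([W_S⁻¹ ∑_{i ∈ S} wᵢ Aᵢ^p]^{1/p}) − ∑_{i ∈ S} h(wᵢ) • f(Aᵢ)`,
where `W_S = ∑_{i ∈ S} wᵢ`. -/
noncomputable def idxF (p : ℝ) (h f : ℝ → ℝ) {n : ℕ} (w : ℕ → ℝ)
    (A : ℕ → Matrix (Fin n) (Fin n) ℂ) (S : Finset ℕ) : Matrix (Fin n) (Fin n) ℂ :=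
  h (∑ i ∈ S, w i) •
      cfc f (mpow ((∑ i ∈ S, w i)⁻¹ • ∑ i ∈ S, w i • mpow (A i) p) (1 / p))
    - ∑ i ∈ S, h (w i) • cfc f (A i)

section HelperLemmas

open scoped MatrixOrder

/-- Hermitian matrices whose spectrum lies in a fixed convex set form a convex set. -/
lemma convex_setOf_spectrum_subset {n : ℕ} {C : Set ℝ} (hC : Convex ℝ C) :
    Convex ℝ {B : Matrix (Fin n) (Fin n) ℂ | IsSelfAdjoint B ∧ spectrum ℝ B ⊆ C} := by
  rintro A ⟨hA, hAC⟩ B ⟨hB, hBC⟩ a b ha hb hab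
  have hAB : IsSelfAdjoint (a • A + b • B) :=
    ((IsSelfAdjoint.all a).smul hA).add ((IsSelfAdjoint.all b).smul hB)
  refine ⟨hAB, fun x hx => ?_⟩
  rcases subsingleton_or_nontrivial (Matrix (Fin n) (Fin n) ℂ) with _ | _
  · simp [spectrum.of_subsingleton] at hx
  have fin_union : (spectrum ℝ A ∪ spectrum ℝ B).Finite :=
    A.finite_real_spectrum.union B.finite_real_spectrum
  have nonempty_union : (spectrum ℝ A ∪ spectrum ℝ B).Nonempty :=
    (ContinuousFunctionalCalculus.spectrum_nonempty A hA).inl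
  have union_subset := Set.union_subset hAC hBC
  obtain ⟨l, hl, hlmin⟩ := Set.exists_min_image _ id fin_union nonempty_union
  obtain ⟨u, hu, humax⟩ := Set.exists_max_image _ id fin_union nonempty_union
  have split (r : ℝ) : algebraMap ℝ (Matrix (Fin n) (Fin n) ℂ) r
      = a • algebraMap ℝ (Matrix (Fin n) (Fin n) ℂ) r
        + b • algebraMap ℝ (Matrix (Fin n) (Fin n) ℂ) r := by
    rw [← add_smul, hab, one_smul]
  have lower : algebraMap ℝ (Matrix (Fin n) (Fin n) ℂ) l ≤ a • A + b • B := by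
    rw [split]
    exact add_le_add
      (smul_le_smul_of_nonneg_left
        (algebraMap_le_of_le_spectrum fun y hy => hlmin y (Or.inl hy)) ha)
      (smul_le_smul_of_nonneg_left
        (algebraMap_le_of_le_spectrum fun y hy => hlmin y (Or.inr hy)) hb)
  have upper : a • A + b • B ≤ algebraMap ℝ (Matrix (Fin n) (Fin n) ℂ) u := by
    rw [split]
    exact add_le_add
      (smul_le_smul_of_nonneg_left
        (le_algebraMap_of_spectrum_le fun y hy => humax y (Or.inl hy)) ha)
      (smul_le_smul_of_nonneg_left
        (le_algebraMap_of_spectrum_le fun y hy => humax y (Or.inr hy)) hb)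
  exact hC.ordConnected.out (union_subset hl) (union_subset hu)
    ⟨(algebraMap_le_iff_le_spectrum hAB).1 lower x hx,
      (le_algebraMap_iff_spectrum_le hAB).1 upper x hx⟩

lemma rpow_one_div_rpow {x p : ℝ} (hx : 0 ≤ x) (hp : p ≠ 0) : (x ^ (1 / p)) ^ p = x := by
  rw [← Real.rpow_mul hx, one_div_mul_cancel hp, Real.rpow_one]

lemma rpow_rpow_one_div {x p : ℝ} (hx : 0 ≤ x) (hp : p ≠ 0) : (x ^ p) ^ (1 / p) = x := by
  rw [← Real.rpow_mul hx, mul_one_div_cancel hp, Real.rpow_one]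

lemma PConvex.convex_image_rpow {p : ℝ} (hp : 0 < p) {K : Set ℝ} (hK : K ⊆ Set.Ici 0)
    (hKp : PConvex p K) : Convex ℝ ((fun x : ℝ => x ^ p) '' K) := by
  rintro _ ⟨x, hx, rfl⟩ _ ⟨y, hy, rfl⟩ a b ha hb hab
  obtain rfl : b = 1 - a := by linarith
  refine ⟨_, hKp x hx y hy a ⟨ha, by linarith⟩, rpow_one_div_rpow ?_ hp.ne'⟩
  exact add_nonneg (mul_nonneg ha (Real.rpow_nonneg (hK hx) p))
    (mul_nonneg hb (Real.rpow_nonneg (hK hy) p))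

lemma spectrum_mpow {n : ℕ} {A : Matrix (Fin n) (Fin n) ℂ} (hA : IsSelfAdjoint A) (p : ℝ) :
    spectrum ℝ (mpow A p) = (fun x : ℝ => x ^ p) '' spectrum ℝ A :=
  cfc_map_spectrum (fun x : ℝ => x ^ p) A hA (A.finite_real_spectrum.continuousOn _)

lemma isSelfAdjoint_mpow {n : ℕ} (A : Matrix (Fin n) (Fin n) ℂ) (p : ℝ) :
    IsSelfAdjoint (mpow A p) :=
  cfc_predicate _ A

lemma spectrum_mpow_one_div_subset {n : ℕ} {p : ℝ} (hp : p ≠ 0) {K : Set ℝ}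
    (hK : K ⊆ Set.Ici 0) {Y : Matrix (Fin n) (Fin n) ℂ} (hY : IsSelfAdjoint Y)
    (hYK : spectrum ℝ Y ⊆ (fun x : ℝ => x ^ p) '' K) :
    spectrum ℝ (mpow Y (1 / p)) ⊆ K := by
  rw [spectrum_mpow hY]
  rintro _ ⟨y, hy, rfl⟩
  obtain ⟨x, hx, rfl⟩ := hYK hy
  simpa only [rpow_rpow_one_div (hK hx) hp] using hx

lemma mpow_mpow_one_div {n : ℕ} {p : ℝ} (hp : p ≠ 0) {Y : Matrix (Fin n) (Fin n) ℂ}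
    (hY : IsSelfAdjoint Y) (hY0 : ∀ y ∈ spectrum ℝ Y, 0 ≤ y) :
    mpow (mpow Y (1 / p)) p = Y := by
  have finite_spectrum := Y.finite_real_spectrum
  unfold mpow
  rw [← cfc_comp _ _ Y hY ((finite_spectrum.image _).continuousOn _)
    (finite_spectrum.continuousOn _)]
  conv_rhs => rw [← cfc_id ℝ Y hY]
  exact cfc_congr fun y hy => rpow_one_div_rpow (hY0 y hy) hp

lemma posSemidef_mpow {n : ℕ} {Y : Matrix (Fin n) (Fin n) ℂ} (p : ℝ)
    (hY0 : ∀ y ∈ spectrum ℝ Y, 0 ≤ y) : (mpow Y p).PosSemidef :=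
  Matrix.nonneg_iff_posSemidef.1 (cfc_nonneg fun y hy => Real.rpow_nonneg (hY0 y hy) p)

/-- A scaled form of operator `(p,h)`-convexity, for super-multiplicative `h` and matrices
given through their `p`-th powers. -/
lemma OperatorPHConvexOn.loewnerLE_smul_cfc {p : ℝ} (hp : 0 < p) {K : Set ℝ} (hK : K ⊆ Set.Ici 0)
    {h f : ℝ → ℝ} (hh0 : ∀ x : ℝ, 0 < x → 0 ≤ h x)
    (hsm : ∀ x y : ℝ, 0 < x → 0 < y → h x * h y ≤ h (x * y))
    (hf : OperatorPHConvexOn p K h f) {n : ℕ} {Y Z : Matrix (Fin n) (Fin n) ℂ}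
    (hY : IsSelfAdjoint Y) (hYK : spectrum ℝ Y ⊆ (fun x : ℝ => x ^ p) '' K)
    (hZ : IsSelfAdjoint Z) (hZK : spectrum ℝ Z ⊆ (fun x : ℝ => x ^ p) '' K)
    {s t : ℝ} (hs : 0 < s) (ht : 0 < t) :
    loewnerLE (h (s + t) • cfc f (mpow ((s + t)⁻¹ • (s • Y + t • Z)) (1 / p)))
      (h s • cfc f (mpow Y (1 / p)) + h t • cfc f (mpow Z (1 / p))) := by
  have image_nonneg : ∀ y ∈ (fun x : ℝ => x ^ p) '' K, 0 ≤ y := by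
    rintro _ ⟨x, hx, rfl⟩
    exact Real.rpow_nonneg (hK hx) p
  have hY0 : ∀ y ∈ spectrum ℝ Y, 0 ≤ y := fun y hy => image_nonneg y (hYK hy)
  have hZ0 : ∀ y ∈ spectrum ℝ Z, 0 ≤ y := fun y hy => image_nonneg y (hZK hy)
  have hYK' := spectrum_mpow_one_div_subset hp.ne' hK hY hYK
  have hZK' := spectrum_mpow_one_div_subset hp.ne' hK hZ hZK
  have hst : 0 < s + t := add_pos hs ht
  have complement : 1 - s / (s + t) = t / (s + t) := by field_simp; ring
  have key := hf.2.2 n _ _ (posSemidef_mpow (1 / p) hY0) (posSemidef_mpow (1 / p) hZ0) hYK' hZK'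
    (s / (s + t)) ⟨div_pos hs hst, (div_lt_one hst).2 (by linarith)⟩
  rw [mpow_mpow_one_div hp.ne' hY hY0, mpow_mpow_one_div hp.ne' hZ hZ0, complement] at key
  have combine : (s / (s + t)) • Y + (t / (s + t)) • Z = (s + t)⁻¹ • (s • Y + t • Z) := by
    simp only [smul_add, smul_smul, div_eq_inv_mul]
  rw [combine] at key
  have scale {r : ℝ} (hr : 0 < r) : h (s + t) * h (r / (s + t)) ≤ h r := by
    simpa only [mul_div_cancel₀ r hst.ne'] using hsm (s + t) (r / (s + t)) hst (div_pos hr hst)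
  refine Matrix.le_iff.1 ((smul_le_smul_of_nonneg_left (Matrix.le_iff.2 key) (hh0 _ hst)).trans ?_)
  rw [smul_add, smul_smul, smul_smul]
  exact add_le_add
    (smul_le_smul_of_nonneg_right (scale hs) (cfc_nonneg fun x hx => hf.1 x (hYK' hx)))
    (smul_le_smul_of_nonneg_right (scale ht) (cfc_nonneg fun x hx => hf.1 x (hZK' hx)))

end HelperLemmas

/-- Index set inequality: for finite nonempty disjoint sets `M, E` of positive integers,
positive weights `wᵢ` and positive semidefinite matrices `Aᵢ` with spectra in `K`,
`F(M ∪ E) ≤ F(M) + F(E)` where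
`F(S) = h(W_S) f([W_S⁻¹ ∑_{i∈S} wᵢ Aᵢ^p]^{1/p}) − ∑_{i∈S} h(wᵢ) f(Aᵢ)`. -/
theorem stmt8 (p : ℝ) (hp : 0 < p) (K : Set ℝ) (hK : K ⊆ Set.Ici 0) (hKp : PConvex p K)
    (h : ℝ → ℝ) (hh0 : ∀ x : ℝ, 0 < x → 0 ≤ h x)
    (hsm : ∀ x y : ℝ, 0 < x → 0 < y → h x * h y ≤ h (x * y))
    (f : ℝ → ℝ) (hf : OperatorPHConvexOn p K h f)
    (M E : Finset ℕ) (hM : M.Nonempty) (hE : E.Nonempty) (hdisj : Disjoint M E)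
    (hpos : ∀ i ∈ M ∪ E, 0 < i)
    (n : ℕ) (w : ℕ → ℝ) (A : ℕ → Matrix (Fin n) (Fin n) ℂ)
    (hw : ∀ i ∈ M ∪ E, 0 < w i)
    (hA : ∀ i ∈ M ∪ E, (A i).PosSemidef) (hsA : ∀ i ∈ M ∪ E, spectrum ℝ (A i) ⊆ K) :
    loewnerLE (idxF p h f w A (M ∪ E)) (idxF p h f w A M + idxF p h f w A E) := by
  have powers_mem : ∀ i ∈ M ∪ E, mpow (A i) p ∈
      {B : Matrix (Fin n) (Fin n) ℂ |
        IsSelfAdjoint B ∧ spectrum ℝ B ⊆ (fun x : ℝ => x ^ p) '' K} := fun i hi =>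
    ⟨isSelfAdjoint_mpow _ _, by
      rw [spectrum_mpow (hA i hi).isHermitian]
      exact Set.image_mono (hsA i hi)⟩
  have weight_pos : ∀ S ⊆ M ∪ E, S.Nonempty → 0 < ∑ i ∈ S, w i := fun S hS hne =>
    Finset.sum_pos (fun i hi => hw i (hS hi)) hne
  have mean_mem : ∀ S ⊆ M ∪ E, S.Nonempty → S.centerMass w (fun i => mpow (A i) p) ∈
      {B : Matrix (Fin n) (Fin n) ℂ |
        IsSelfAdjoint B ∧ spectrum ℝ B ⊆ (fun x : ℝ => x ^ p) '' K} := fun S hS hne =>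
    (convex_setOf_spectrum_subset (hKp.convex_image_rpow hp hK)).centerMass_mem
      (fun i hi => (hw i (hS hi)).le) (weight_pos S hS hne) (fun i hi => powers_mem i (hS hi))
  have wM := weight_pos M Finset.subset_union_left hM
  have wE := weight_pos E Finset.subset_union_right hE
  obtain ⟨hY, hYK⟩ := mean_mem M Finset.subset_union_left hM
  obtain ⟨hZ, hZK⟩ := mean_mem E Finset.subset_union_right hE
  have key := hf.loewnerLE_smul_cfc hp hK hh0 hsm hY hYK hZ hZK wM wE
  unfold loewnerLE at key
  simp only [Finset.centerMass, smul_inv_smul₀ wM.ne', smul_inv_smul₀ wE.ne'] at key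
  unfold loewnerLE idxF
  rw [Finset.sum_union hdisj, Finset.sum_union hdisj, Finset.sum_union hdisj]
  convert key using 1
  abel
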